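/- arXiv:2201.12479 — 3 statements merged into one kernel-verified Lean document; each statement's English description precedes it below -/
import Mathlib

section
/- Let $g=(a_{ij})$ be an $n\times n$ real lower triangular matrix with $a_{ij}>0$ for all $i\geq j$, all of whose minors of the form $\Delta_{J_1,J_2}$ (with $J_1,J_2$ intervals of consecutive indices of equal size, $J_1$ above $J_2$ in the sense used for total positivity of lower triangular matrices) are positive. Then for each $k$, the eigenspace $V_k=\{(A_1,\dots,A_n)\in\mathbb{R}^n : \sum_j a_{ij}A_j = a_{kk}A_i \text{ for all } i\}$ is one-dimensional. In particular every eigenspace of $g$ is one-dimensional, so $g$ is a regular element of $GL_n(\mathbb{R})$. -/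
/-- A real matrix is totally nonnegative if all its minors are nonnegative. -/
def Matrix.IsTotallyNonneg {m n : ℕ} (A : Matrix (Fin m) (Fin n) ℝ) : Prop :=
  ∀ (k : ℕ) (r : Fin k → Fin m) (c : Fin k → Fin n), StrictMono r → StrictMono c →
    0 ≤ (A.submatrix r c).det

namespace Matrix.IsTotallyNonneg

variable {m n : ℕ}

theorem submatrix {A : Matrix (Fin m) (Fin n) ℝ} (hA : A.IsTotallyNonneg) {m' n' : ℕ}
    {r : Fin m' → Fin m} {c : Fin n' → Fin n} (hr : StrictMono r) (hc : StrictMono c) :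
    (A.submatrix r c).IsTotallyNonneg := fun k r' c' hr' hc' => by
  rw [Matrix.submatrix_submatrix]
  exact hA k _ _ (hr.comp hr') (hc.comp hc')

theorem det_nonneg {A : Matrix (Fin n) (Fin n) ℝ} (hA : A.IsTotallyNonneg) : 0 ≤ A.det := by
  simpa using hA n id id strictMono_id strictMono_id

theorem det_submatrix_nonneg_of_monotone {A : Matrix (Fin m) (Fin n) ℝ} (hA : A.IsTotallyNonneg)
    {k : ℕ} {r : Fin k → Fin m} {c : Fin k → Fin n} (hr : Monotone r) (hc : StrictMono c) :
    0 ≤ (A.submatrix r c).det := by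
  by_cases hinj : Function.Injective r
  · exact hA k r c (hr.strictMono_of_injective hinj) hc
  · obtain ⟨a, b, hab, hne⟩ : ∃ a b, r a = r b ∧ a ≠ b := by
      simpa [Function.Injective] using hinj
    refine (Matrix.det_zero_of_row_eq hne ?_).ge
    ext t
    simp [hab]

/-- Adding a nonnegative multiple of a row to the next one preserves total nonnegativity. -/
theorem updateRow_succ {A : Matrix (Fin (m + 1)) (Fin n) ℝ} (hA : A.IsTotallyNonneg) (i : Fin m)
    {x : ℝ} (hx : 0 ≤ x) :
    (A.updateRow i.succ (A i.succ + x • A i.castSucc)).IsTotallyNonneg := by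
  intro k r c hr hc
  by_cases h : ∃ s, r s = i.succ
  · obtain ⟨s, hs⟩ := h
    have hne : ∀ a, a ≠ s → r a ≠ i.succ := fun a ha h => ha (hr.injective (h.trans hs.symm))
    have hsub : (A.updateRow i.succ (A i.succ + x • A i.castSucc)).submatrix r c =
        (A.submatrix r c).updateRow s
          (A.submatrix r c s + x • fun t => A i.castSucc (c t)) := by
      ext a t
      by_cases ha : a = s
      · subst ha
        simp [hs]
      · simp [Matrix.updateRow_ne ha, Matrix.updateRow_ne (hne a ha)]
    have hupd : (A.submatrix r c).updateRow s (fun t => A i.castSucc (c t)) =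
        A.submatrix (Function.update r s i.castSucc) c := by
      ext a t
      by_cases ha : a = s
      · subst ha
        simp
      · simp [Matrix.updateRow_ne ha, Function.update_of_ne ha]
    have hmono : Monotone (Function.update r s i.castSucc) := by
      intro a b hab
      rcases hab.eq_or_lt with rfl | hlt
      · exact le_rfl
      have hrlt := hr hlt
      by_cases ha : a = s
      · subst ha
        rw [Function.update_self, Function.update_of_ne hlt.ne']
        rw [hs] at hrlt
        exact (Fin.castSucc_lt_succ.trans hrlt).le
      · by_cases hb : b = s
        · subst hb
          rw [Function.update_self, Function.update_of_ne ha]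
          rw [hs] at hrlt
          exact Fin.le_castSucc_iff.2 hrlt
        · rw [Function.update_of_ne ha, Function.update_of_ne hb]
          exact hrlt.le
    rw [hsub, Matrix.det_updateRow_add, Matrix.det_updateRow_smul, Matrix.updateRow_eq_self, hupd]
    exact add_nonneg (hA k r c hr hc)
      (mul_nonneg hx (hA.det_submatrix_nonneg_of_monotone hmono hc))
  · push Not at h
    have hsub : (A.updateRow i.succ (A i.succ + x • A i.castSucc)).submatrix r c =
        A.submatrix r c := by
      ext a t
      simp [Matrix.updateRow_ne (h a)]
    rw [hsub]
    exact hA k r c hr hc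

theorem of_submatrix_succ {A : Matrix (Fin (m + 1)) (Fin (n + 1)) ℝ} (h00 : 0 ≤ A 0 0)
    (hrow : ∀ j : Fin n, A 0 j.succ = 0) (hcol : ∀ i : Fin m, A i.succ 0 = 0)
    (hA : (A.submatrix Fin.succ Fin.succ).IsTotallyNonneg) : A.IsTotallyNonneg := by
  have hrow' : ∀ j, j ≠ 0 → A 0 j = 0 := fun j hj => by
    obtain ⟨j, rfl⟩ := Fin.exists_succ_eq.2 hj
    exact hrow j
  have hcol' : ∀ i, i ≠ 0 → A i 0 = 0 := fun i hi => by
    obtain ⟨i, rfl⟩ := Fin.exists_succ_eq.2 hi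
    exact hcol i
  have main : ∀ {k : ℕ} {r : Fin k → Fin (m + 1)} {c : Fin k → Fin (n + 1)}, StrictMono r →
      StrictMono c → (∀ s, r s ≠ 0) → (∀ s, c s ≠ 0) → 0 ≤ (A.submatrix r c).det := by
    intro k r c hr hc hr0 hc0
    have h := hA k (fun s => (r s).pred (hr0 s)) (fun s => (c s).pred (hc0 s))
      (fun a b hab => Fin.pred_lt_pred_iff.2 (hr hab))
      (fun a b hab => Fin.pred_lt_pred_iff.2 (hc hab))
    rw [Matrix.submatrix_submatrix] at h
    convert h using 3 <;> ext s <;> simp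
  intro k r c hr hc
  cases k with
  | zero => simp
  | succ k =>
    have hr1 : ∀ s, s ≠ 0 → r s ≠ 0 := fun s hs =>
      Fin.pos_iff_ne_zero.1 ((Fin.zero_le _).trans_lt (hr (Fin.pos_iff_ne_zero.2 hs)))
    have hc1 : ∀ s, s ≠ 0 → c s ≠ 0 := fun s hs =>
      Fin.pos_iff_ne_zero.1 ((Fin.zero_le _).trans_lt (hc (Fin.pos_iff_ne_zero.2 hs)))
    by_cases hr0 : r 0 = 0
    · by_cases hc0 : c 0 = 0
      · rw [Matrix.det_succ_row_zero, Fin.sum_univ_succ, Finset.sum_eq_zero, add_zero]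
        · have := main (hr.comp Fin.strictMono_succ) (hc.comp Fin.strictMono_succ)
            (fun s => hr1 _ s.succ_ne_zero) (fun s => hc1 _ s.succ_ne_zero)
          simpa [hr0, hc0, Function.comp_def] using mul_nonneg h00 this
        · intro s _
          simp [hr0, hrow' _ (hc1 _ s.succ_ne_zero)]
      · refine (Matrix.det_eq_zero_of_row_eq_zero 0 fun t => ?_).ge
        have : c t ≠ 0 := if ht : t = 0 then ht ▸ hc0 else hc1 t ht
        simp [hr0, hrow' _ this]
    · have hr2 : ∀ s, r s ≠ 0 := fun t => if ht : t = 0 then ht ▸ hr0 else hr1 t ht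
      by_cases hc0 : c 0 = 0
      · refine (Matrix.det_eq_zero_of_column_eq_zero 0 fun t => ?_).ge
        simp [hc0, hcol' _ (hr2 t)]
      · exact main hr hc hr2 fun t => if ht : t = 0 then ht ▸ hc0 else hc1 t ht

/-- A lower triangular matrix whose minors on consecutive rows and initial columns are positive
is totally nonnegative. -/
theorem of_initial_minors_pos {n : ℕ} (g : Matrix (Fin n) (Fin n) ℝ)
    (hzero : ∀ i j : Fin n, i < j → g i j = 0)
    (hminor : ∀ (k p : ℕ) (hpk : p + k ≤ n),
      0 < (Matrix.of fun s t : Fin k => g ⟨p + s, by omega⟩ ⟨t, by omega⟩).det) :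
    g.IsTotallyNonneg := by
  induction n with
  | zero =>
    intro k r c hr hc
    cases k with
    | zero => simp
    | succ k => exact (r 0).elim0
  | succ n ih =>
    have hcol : ∀ i, 0 < g i 0 := fun i => by
      simpa [Matrix.det_unique] using hminor 1 i (by omega)
    set x : Fin n → ℝ := fun i => g i.succ 0 / g i.castSucc 0 with hx
    have hx0 : ∀ i, 0 ≤ x i := fun i => (div_pos (hcol _) (hcol _)).le
    have hxg : ∀ i, x i * g i.castSucc 0 = g i.succ 0 := fun i =>
      div_mul_cancel₀ _ (hcol _).ne'
    -- One step of Neville elimination.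
    set g' : Matrix (Fin n) (Fin n) ℝ :=
      Matrix.of fun i j => g i.succ j.succ - x i * g i.castSucc j.succ with hg'
    have hg'_tn : g'.IsTotallyNonneg := by
      refine ih g' (fun i j hij => ?_) fun k p hpk => ?_
      · have h1 : g i.succ j.succ = 0 := hzero _ _ (Fin.succ_lt_succ_iff.2 hij)
        have h2 : g i.castSucc j.succ = 0 := hzero _ _ (Fin.castSucc_lt_succ.trans
          (Fin.succ_lt_succ_iff.2 hij))
        simp [hg', h1, h2]
      · have h := hminor (k + 1) p (by omega)
        rw [Matrix.det_eq_of_forall_row_eq_smul_add_pred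
          (B := Matrix.of (Fin.cons (fun t : Fin (k + 1) => g ⟨p, by omega⟩ ⟨t, by omega⟩)
            fun (s : Fin k) (t : Fin (k + 1)) =>
              g ⟨p + s + 1, by omega⟩ ⟨t, by omega⟩ -
                x ⟨p + s, by omega⟩ * g ⟨p + s, by omega⟩ ⟨t, by omega⟩))
          (fun s => x ⟨p + s, by omega⟩) (fun j => by simp)
          (fun i j => by simp [add_assoc])] at h
        rw [Matrix.det_succ_column_zero, Fin.sum_univ_succ, Finset.sum_eq_zero, add_zero] at h
        · refine pos_of_mul_pos_right (a := g ⟨p, by omega⟩ 0) ?_ (hcol _).le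
          refine h.trans_eq ?_
          simp
          left
          rfl
        · intro s _
          have := hxg ⟨p + s, by omega⟩
          simp only [Fin.succ_mk, Fin.castSucc_mk] at this
          simp [this]
    set X : ℕ → Matrix (Fin (n + 1)) (Fin (n + 1)) ℝ := fun l =>
      Matrix.of fun i j => if (i : ℕ) ≤ l then g i j else
        Fin.cases 0 (fun i' => g i'.succ j - x i' * g i'.castSucc j) i with hX
    have hX_tn : ∀ l, (X l).IsTotallyNonneg := by
      intro l
      induction l with
      | zero =>
        refine of_submatrix_succ ?_ (fun j => ?_) (fun i => ?_) ?_
        · simpa [hX] using (hcol 0).le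
        · simpa [hX] using hzero 0 j.succ (Fin.succ_pos j)
        · simp [hX, hxg]
        · convert hg'_tn using 1
          ext i j
          simp [hX, hg']
      | succ l ihl =>
        by_cases hl : l < n
        · convert ihl.updateRow_succ ⟨l, hl⟩ (hx0 ⟨l, hl⟩) using 1
          ext i j
          by_cases hi : i = (⟨l, hl⟩ : Fin n).succ
          · subst hi
            simp [hX]
          · have : (i : ℕ) ≤ l + 1 ↔ (i : ℕ) ≤ l := by
              have : (i : ℕ) ≠ l + 1 := fun h => hi (Fin.ext h)
              omega
            rw [Matrix.updateRow_ne hi]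
            simp [hX, this]
        · convert ihl using 1
          ext i j
          have h1 : (i : ℕ) ≤ l := by omega
          have h2 : (i : ℕ) ≤ l + 1 := by omega
          simp [hX, h1, h2]
    convert hX_tn n using 1
    ext i j
    simp [hX, Nat.lt_succ_iff.1 i.isLt]

/-- Decreasing superdiagonal entries of a totally nonnegative matrix does not decrease its
determinant. -/
theorem det_le_det_sub_superdiagonal {N : ℕ} {A : Matrix (Fin N) (Fin N) ℝ}
    (hA : A.IsTotallyNonneg) {b : ℕ → ℝ} (hb : ∀ t, 0 ≤ b t) :
    A.det ≤ (A - Matrix.of fun s t : Fin N => if (s : ℕ) + 1 = t then b t else 0).det := by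
  suffices H : ∀ (m : ℕ) {N : ℕ} {A : Matrix (Fin N) (Fin N) ℝ}, A.IsTotallyNonneg →
      ∀ {b : ℕ → ℝ}, (∀ t, 0 ≤ b t) →
      A.det ≤ (A - Matrix.of fun s t : Fin N =>
        if (s : ℕ) + 1 = t ∧ (t : ℕ) < m then b t else 0).det by
    convert H N hA hb using 6 with s t
    simp
  clear hA hb b A N
  intro m
  induction m with
  | zero =>
    intro N A _ b _
    refine le_of_eq (congrArg Matrix.det ?_)
    ext s t
    simp
  | succ m ih =>
    intro N A hA b hb
    by_cases hm : m = 0 ∨ N ≤ m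
    · convert ih hA hb using 6 with s t
      congr 1
      exact propext (and_congr_right fun _ => by omega)
    · obtain ⟨m, rfl⟩ := Nat.exists_eq_succ_of_ne_zero (fun h => hm (Or.inl h))
      obtain ⟨N, rfl⟩ := Nat.exists_eq_succ_of_ne_zero (show N ≠ 0 by omega)
      have hmN : m + 1 < N + 1 := by omega
      set i : Fin (N + 1) := ⟨m, by omega⟩ with hi
      set j : Fin (N + 1) := ⟨m + 1, hmN⟩ with hj
      set C : Matrix (Fin (N + 1)) (Fin (N + 1)) ℝ := A - Matrix.of fun s t : Fin (N + 1) =>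
        if (s : ℕ) + 1 = t ∧ (t : ℕ) < m + 1 then b t else 0 with hC
      have hsplit : (A - Matrix.of fun s t : Fin (N + 1) =>
          if (s : ℕ) + 1 = t ∧ (t : ℕ) < m + 1 + 1 then b t else 0) =
          C.updateCol j (C.col j + (-b (m + 1)) • Pi.single i 1) := by
        ext s t
        by_cases ht : t = j
        · subst ht
          by_cases hs : s = i
          · subst hs
            simp [hC, hi, hj, sub_eq_add_neg]
          · have : (s : ℕ) ≠ m := fun h => hs (Fin.ext h)
            simp [hC, hj, hs, this]
        · have h1 : (t : ℕ) ≠ m + 1 := fun h => ht (Fin.ext h)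
          have h2 : (t : ℕ) < m + 1 + 1 ↔ (t : ℕ) < m + 1 := by omega
          rw [Matrix.updateCol_ne ht]
          simp only [hC, Matrix.sub_apply, Matrix.of_apply, h2]
      have hdel : (C.updateCol j (Pi.single i 1)).det =
          -(C.submatrix i.succAbove j.succAbove).det := by
        rw [Matrix.det_succ_column _ j, Finset.sum_eq_single i]
        · have : (-1 : ℝ) ^ (m + (m + 1)) = -1 := Odd.neg_one_pow ⟨m, by ring⟩
          simp [hi, hj, this]
        · intro s _ hs
          simp [hs]
        · simp
      have hsub : C.submatrix i.succAbove j.succAbove =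
          A.submatrix i.succAbove j.succAbove - Matrix.of fun s t : Fin N =>
            if (s : ℕ) + 1 = t ∧ (t : ℕ) < m + 1 then b t else 0 := by
        ext s t
        have hs : ((i.succAbove s : Fin (N + 1)) : ℕ) = if (s : ℕ) < m then (s : ℕ) else s + 1 := by
          simp only [Fin.succAbove, Fin.lt_def, hi]
          split_ifs <;> simp_all
        have ht : ((j.succAbove t : Fin (N + 1)) : ℕ) =
            if (t : ℕ) < m + 1 then (t : ℕ) else t + 1 := by
          simp only [Fin.succAbove, Fin.lt_def, hj]
          split_ifs <;> simp_all
        simp only [hC, Matrix.submatrix_apply, Matrix.sub_apply, Matrix.of_apply, hs, ht]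
        congr 1
        split_ifs <;> first | rfl | omega
      have hA' := hA.submatrix (Fin.strictMono_succAbove i) (Fin.strictMono_succAbove j)
      have h1 := ih hA hb
      have h2 := hA'.det_nonneg.trans (ih hA' hb)
      rw [← hsub] at h2
      rw [hsplit, Matrix.det_updateCol_add, Matrix.det_updateCol_smul,
        show C.updateCol j (C.col j) = C from Matrix.updateCol_eq_self C j, hdel]
      have h3 := mul_nonneg (hb (m + 1)) h2
      linarith

end Matrix.IsTotallyNonneg


/-- A totally positive lower triangular matrix (all entries on or below the
diagonal positive, and all interval minors that are not identically zero on
lower triangular matrices positive) has all eigenspaces one-dimensional;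
in particular it is regular. -/
theorem stmt0 {n : ℕ} (g : Matrix (Fin n) (Fin n) ℝ)
    (hzero : ∀ i j : Fin n, (i : ℕ) < j → g i j = 0)
    (hpos : ∀ i j : Fin n, (j : ℕ) ≤ i → 0 < g i j)
    (hminor : ∀ (k p q : ℕ) (hq : q ≤ p) (hpk : p + k ≤ n),
      0 < Matrix.det (Matrix.of fun s t : Fin k =>
        g ⟨p + s, by have := s.isLt; omega⟩ ⟨q + t, by have := t.isLt; omega⟩)) :
    (∀ k : Fin n,
      Module.finrank ℝ (Module.End.eigenspace (Matrix.mulVecLin g) (g k k)) = 1) ∧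
    (∀ μ : ℝ,
      Module.finrank ℝ (Module.End.eigenspace (Matrix.mulVecLin g) μ) ≤ 1) := by
  have hlt : g.BlockTriangular OrderDual.toDual := fun i j hij => hzero i j hij
  have hdet : ∀ μ : ℝ, (g - μ • (1 : Matrix (Fin n) (Fin n) ℝ)).det = ∏ i, (g i i - μ) := fun μ => by
    rw [Matrix.det_of_isLowerTriangular]
    · simp
    · refine hlt.sub fun i j hij => ?_
      have hne : i ≠ j := fun h => hij.ne (congrArg OrderDual.toDual h.symm)
      simp [hne]
  have hmem : ∀ (μ : ℝ) (v : Fin n → ℝ), v ∈ Module.End.eigenspace (Matrix.mulVecLin g) μ ↔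
      (g - μ • (1 : Matrix (Fin n) (Fin n) ℝ)).mulVec v = 0 := fun μ v => by
    rw [Module.End.mem_eigenspace_iff, Matrix.sub_mulVec, Matrix.smul_mulVec, Matrix.one_mulVec,
      sub_eq_zero, Matrix.mulVecLin_apply]
  have hle : ∀ μ : ℝ,
      Module.finrank ℝ (Module.End.eigenspace (Matrix.mulVecLin g) μ) ≤ 1 := by
    intro μ
    rcases lt_or_ge μ 0 with hμ | hμ
    · have hne : (g - μ • (1 : Matrix (Fin n) (Fin n) ℝ)).det ≠ 0 := by
        rw [hdet]
        exact (Finset.prod_pos fun i _ => by linarith [hpos i i le_rfl]).ne'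
      have hbot : Module.End.eigenspace (Matrix.mulVecLin g) μ = ⊥ := by
        rw [Submodule.eq_bot_iff]
        exact fun v hv => Matrix.eq_zero_of_mulVec_eq_zero hne ((hmem μ v).1 hv)
      rw [hbot]
      simp
    cases n with
    | zero => exact (Submodule.finrank_le _).trans (by simp)
    | succ N =>
      have htn : g.IsTotallyNonneg := Matrix.IsTotallyNonneg.of_initial_minors_pos g
        (fun i j hij => hzero i j hij) fun k p hpk => by
          simpa using hminor k p 0 (Nat.zero_le p) hpk
      have hA := htn.submatrix (Fin.strictMono_succ (n := N)) (Fin.strictMono_castSucc (n := N))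
      have hApos : 0 < (g.submatrix (Fin.succ (n := N)) Fin.castSucc).det := by
        convert hminor N 1 0 zero_le_one (by omega) using 2
        ext s t
        simp only [Matrix.submatrix_apply, Matrix.of_apply]
        congr 1 <;> ext <;> simp [add_comm]
      have hM : ((g - μ • (1 : Matrix (Fin (N + 1)) (Fin (N + 1)) ℝ)).submatrix
          (Fin.succ (n := N)) Fin.castSucc).det ≠ 0 := by
        refine (hApos.trans_le ((hA.det_le_det_sub_superdiagonal
          (b := fun _ => μ) fun _ => hμ).trans_eq ?_)).ne'
        congr 1
        ext s t
        simp [Matrix.one_apply, Fin.ext_iff]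
      let f : Module.End.eigenspace (Matrix.mulVecLin g) μ →ₗ[ℝ] ℝ :=
        (LinearMap.proj (Fin.last N)).comp (Submodule.subtype _)
      have hf : Function.Injective f := by
        rw [← LinearMap.ker_eq_bot, LinearMap.ker_eq_bot']
        rintro ⟨v, hv⟩ hv0
        have hlast : v (Fin.last N) = 0 := hv0
        have hzero' : (fun s : Fin N => v s.castSucc) = 0 := by
          refine Matrix.eq_zero_of_mulVec_eq_zero hM ?_
          ext s
          have h := congrFun ((hmem μ v).1 hv) s.succ
          rw [Matrix.mulVec, dotProduct, Fin.sum_univ_castSucc, hlast, mul_zero, add_zero] at h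
          exact h
        ext i
        refine Fin.lastCases hlast (fun s => congrFun hzero' s) i
      simpa using LinearMap.finrank_le_finrank_of_injective hf
  refine ⟨fun k => le_antisymm (hle _) ?_, hle⟩
  obtain ⟨v, hv0, hv⟩ := Matrix.exists_mulVec_eq_zero_iff.2
    ((hdet (g k k)).trans (Finset.prod_eq_zero (Finset.mem_univ k) (sub_self _)))
  rw [Nat.one_le_iff_ne_zero, Ne, Submodule.finrank_eq_zero, Submodule.eq_bot_iff]
  exact fun h => hv0 (h v ((hmem _ v).2 hv))
end

section
/- Let $W$ be a Coxeter group with simple reflections indexed by $I$, and $J \subset I$. The map $\pi_J: W \to W_J$ defined on generators by $s_i \mapsto s_i$ if $i \in J$ and $s_i \mapsto 1$ if $i \notin J$, extended multiplicatively along reduced expressions using the Demazure product, is a well-defined morphism of monoids from $(W, *)$ to $(W_J, *)$. -/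
namespace CoxeterMatrix

variable {B : Type*} (M : CoxeterMatrix B)

/-- The functional `v ↦ 2⟨αᵢ, v⟩` of the geometric representation. -/
noncomputable def geometricCoroot (i : B) : Module.Dual ℝ (B →₀ ℝ) :=
  Finsupp.lift ℝ ℝ B fun j ↦ -2 * Real.cos (Real.pi / M i j)

theorem geometricCoroot_single (i j : B) :
    M.geometricCoroot i (Finsupp.single j 1) = -2 * Real.cos (Real.pi / M i j) := by
  simp [geometricCoroot]

theorem geometricCoroot_single_self (i : B) :
    M.geometricCoroot i (Finsupp.single i 1) = 2 := by
  simp [geometricCoroot_single]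

/-- The simple reflections of the geometric representation. -/
noncomputable def geometricReflection (i : B) : (B →₀ ℝ) ≃ₗ[ℝ] (B →₀ ℝ) :=
  Module.reflection (M.geometricCoroot_single_self i)

theorem geometricReflection_isLiftable : M.IsLiftable M.geometricReflection := by
  intro i j
  by_cases hij : i = j
  · subst hij
    ext1 z
    simpa [geometricReflection] using
      Module.involutive_reflection (M.geometricCoroot_single_self i) z
  have hf := M.geometricCoroot_single i j
  have hg := M.geometricCoroot_single j i
  rw [M.symmetric j i] at hg
  have h1 := M.off_diagonal i j hij
  change M i j ≠ 1 at h1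
  generalize hm : M i j = m at *
  rcases Nat.eq_zero_or_pos m with rfl | hpos
  · simp
  ext1 z
  rw [geometricReflection, geometricReflection, Module.reflection_mul_reflection_pow_apply]
  rw [hf, hg]
  have ht : -2 * Real.cos (Real.pi / m) * (-2 * Real.cos (Real.pi / m)) - 2
      = 2 * Real.cos (2 * (Real.pi / m)) := by
    rw [Real.cos_two_mul]; ring
  rw [ht]
  rcases (show m = 2 ∨ 3 ≤ m by omega) with rfl | h3
  · have : 2 * (Real.pi / 2) = Real.pi := by ring
    simp [this, Polynomial.Chebyshev.S_one]
    module
  have hmR : (3 : ℝ) ≤ m := by exact_mod_cast h3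
  have hsin : Real.sin (2 * (Real.pi / m)) ≠ 0 := by
    apply ne_of_gt
    apply Real.sin_pos_of_pos_of_lt_pi
    · have := Real.pi_pos
      positivity
    · rw [← mul_div_assoc, div_lt_iff₀ (by linarith)]
      nlinarith [Real.pi_pos]
  have hS := fun n : ℤ ↦ Polynomial.Chebyshev.S_two_mul_real_cos (2 * (Real.pi / m)) n
  rcases Nat.even_or_odd' m with ⟨k, hk | hk⟩
  · have e1 : ((m : ℤ) - 2) / 2 = k - 1 := by omega
    have e2 : ((m : ℤ) - 1) / 2 = k - 1 := by omega
    have h0 : (Polynomial.Chebyshev.S ℝ ((k : ℤ) - 1)).eval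
        (2 * Real.cos (2 * (Real.pi / m))) = 0 := by
      apply (mul_eq_zero.mp ?_).resolve_right hsin
      rw [hS, ← Real.sin_pi]
      congr 1
      have : (m : ℝ) = 2 * k := by exact_mod_cast hk
      rw [this] at hmR ⊢
      have hk0 : (k : ℝ) ≠ 0 := by intro h; norm_num [h] at hmR
      push_cast
      field_simp
      ring
    rw [e1, e2, h0]
    simp
  · have e1 : ((m : ℤ) - 2) / 2 = k - 1 := by omega
    have e2 : ((m : ℤ) - 1) / 2 = k := by omega
    have e3 : ((m : ℤ) - 3) / 2 = k - 1 := by omega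
    have e4 : (m : ℤ) / 2 = k := by omega
    have h0 : (Polynomial.Chebyshev.S ℝ (k : ℤ)).eval (2 * Real.cos (2 * (Real.pi / m))) +
        (Polynomial.Chebyshev.S ℝ ((k : ℤ) - 1)).eval
        (2 * Real.cos (2 * (Real.pi / m))) = 0 := by
      apply (mul_eq_zero.mp ?_).resolve_right hsin
      rw [add_mul, hS, hS, ← eq_neg_iff_add_eq_zero, ← Real.sin_neg, ← Real.sin_add_two_pi (-_)]
      congr 1
      have : (m : ℝ) = 2 * k + 1 := by exact_mod_cast hk
      rw [this] at hmR ⊢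
      push_cast
      field_simp
      ring
    rw [e1, e2, e3, e4, h0]
    simp

end CoxeterMatrix

namespace CoxeterSystem

variable {B W : Type*} [Group W] {M : CoxeterMatrix B} (cs : CoxeterSystem M W)

theorem simple_injective : Function.Injective cs.simple := by
  intro i j h
  by_contra hij
  have h' := congrArg (cs.lift ⟨_, M.geometricReflection_isLiftable⟩) h
  rw [lift_apply_simple, lift_apply_simple] at h'
  have := congrArg (fun g : (B →₀ ℝ) ≃ₗ[ℝ] (B →₀ ℝ) ↦ g (Finsupp.single i 1) i) h'
  simp [CoxeterMatrix.geometricReflection, Module.reflection_apply, M.geometricCoroot_single,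
    Ne.symm hij] at this
  norm_num at this

/-- A Demazure product on a Coxeter group. -/
structure IsDemazureProduct (star : W → W → W) : Prop where
  assoc : ∀ u v w : W, star (star u v) w = star u (star v w)
  one_star : ∀ w : W, star 1 w = w
  star_one : ∀ w : W, star w 1 = w
  simple_star_of_lt : ∀ (i : B) (w : W), cs.length w < cs.length (cs.simple i * w) →
    star (cs.simple i) w = cs.simple i * w
  simple_star_of_gt : ∀ (i : B) (w : W), cs.length (cs.simple i * w) < cs.length w →
    star (cs.simple i) w = w

variable {cs}

namespace IsReduced

theorem of_cons {i : B} {ω : List B} (h : cs.IsReduced (i :: ω)) : cs.IsReduced ω := by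
  simpa using h.drop 1

theorem length_lt_of_cons {i : B} {ω : List B} (h : cs.IsReduced (i :: ω)) :
    cs.length (cs.wordProd ω) < cs.length (cs.simple i * cs.wordProd ω) := by
  rw [← wordProd_cons, h.eq, h.of_cons.eq]
  simp

theorem cons {i : B} {ω : List B} (h : cs.IsReduced ω)
    (hi : cs.length (cs.wordProd ω) < cs.length (cs.simple i * cs.wordProd ω)) :
    cs.IsReduced (i :: ω) := by
  have h1 := cs.length_wordProd_le (i :: ω)
  rw [wordProd_cons] at h1
  rw [h.eq] at hi
  rw [IsReduced, wordProd_cons]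
  simp only [List.length_cons] at *
  omega

theorem not_cons_cons (i : B) (ω : List B) : ¬ cs.IsReduced (i :: i :: ω) := by
  intro h
  have h1 := h.length_lt_of_cons
  have h2 := h.of_cons.length_lt_of_cons
  rw [wordProd_cons, simple_mul_simple_cancel_left] at h1
  omega

theorem mem_of_wordProd_cons_eq_cons {i j : B} {γ δ : List B} (hij : i ≠ j)
    (hδ : ∀ k ∈ δ, k = i ∨ k = j) (hγr : cs.IsReduced (i :: γ)) (hδr : cs.IsReduced (j :: δ))
    (h : cs.wordProd (i :: γ) = cs.wordProd (j :: δ)) : i ∈ δ := by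
  have hlen : (i :: γ).length = (j :: δ).length := by rw [← hγr.eq, h, hδr.eq]
  rcases δ with _ | ⟨k, δ⟩
  · simp only [List.length_cons, List.length_nil, Nat.add_right_cancel_iff] at hlen
    rw [List.length_eq_zero_iff.mp hlen, wordProd_singleton, wordProd_singleton] at h
    exact absurd (cs.simple_injective h) hij
  · rcases hδ k (by simp) with rfl | rfl
    · simp
    · exact absurd hδr (not_cons_cons k δ)

end IsReduced

variable (cs) in
theorem exists_mul_minimal (K : Set B) (w : W) :
    ∃ u ∈ Subgroup.closure (cs.simple '' K), ∃ v, w = u * v ∧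
      ∀ k ∈ K, cs.length v < cs.length (cs.simple k * v) := by
  induction hn : cs.length w using Nat.strong_induction_on generalizing w with
  | _ n ih =>
    by_cases h : ∀ k ∈ K, cs.length w < cs.length (cs.simple k * w)
    · exact ⟨1, one_mem _, w, by simp, h⟩
    push Not at h
    obtain ⟨k, hk, hle⟩ := h
    have := cs.length_simple_mul_ne w k
    obtain ⟨u, hu, v, huv, hv⟩ := ih _ (by omega) (cs.simple k * w) rfl
    refine ⟨cs.simple k * u, mul_mem (Subgroup.subset_closure ⟨k, hk, rfl⟩) hu, v, ?_, hv⟩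
    rw [mul_assoc, ← huv, simple_mul_simple_cancel_left]

namespace IsDemazureProduct

variable {star : W → W → W}

theorem simple_star_self (hs : cs.IsDemazureProduct star)
    (i : B) : star (cs.simple i) (cs.simple i) = cs.simple i :=
  hs.simple_star_of_gt i _ (by simp)

theorem star_eq_mul (hs : cs.IsDemazureProduct star)
    {u v : W} (h : cs.length (u * v) = cs.length u + cs.length v) :
    star u v = u * v := by
  obtain ⟨ω, hω, rfl⟩ := cs.exists_isReduced u
  induction ω with
  | nil => simp [hs.one_star]
  | cons i ω ih =>
    have h1 := hω.length_lt_of_cons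
    have h2 := cs.length_mul_le (cs.wordProd ω) v
    have h3 := cs.length_mul_le (cs.simple i) (cs.wordProd ω * v)
    have h4 := hω.eq
    have h5 := hω.of_cons.eq
    rw [wordProd_cons] at h h4 ⊢
    rw [mul_assoc] at h ⊢
    simp only [length_simple, List.length_cons] at h3 h4
    rw [← hs.simple_star_of_lt i _ h1, hs.assoc, ih hω.of_cons (by omega),
      hs.simple_star_of_lt i _ (by omega)]

/-- The folding condition. -/
theorem simple_mul_eq_mul_simple (hs : cs.IsDemazureProduct star) {w : W} {i j : B}
    (hi : cs.length w < cs.length (cs.simple i * w))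
    (hj : cs.length w < cs.length (w * cs.simple j))
    (hij : cs.length (cs.simple i * w * cs.simple j) < cs.length (cs.simple i * w)) :
    cs.simple i * w = w * cs.simple j := by
  have li := cs.length_simple_mul w i
  have lj := cs.length_mul_simple w j
  have lij := cs.length_mul_simple (cs.simple i * w) j
  have h1 : star (cs.simple i * w) (cs.simple j) = cs.simple i * w := by
    have h : star (cs.simple i * w * cs.simple j) (cs.simple j) = cs.simple i * w := by
      rw [hs.star_eq_mul] <;> simp only [simple_mul_simple_cancel_right, length_simple]
      omega
    nth_rw 1 [← h]
    rw [hs.assoc, hs.simple_star_self, h]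
  have h2 : star (cs.simple i * w) (cs.simple j) = w * cs.simple j := by
    rw [← hs.simple_star_of_lt i w hi, hs.assoc, hs.star_eq_mul (u := w),
      hs.simple_star_of_gt]
    · rw [← mul_assoc]; omega
    · rw [length_simple]; omega
  rw [← h1, h2]

/-- Shortest words in a given set of letters are reduced. -/
theorem isReduced_of_forall_le (hs : cs.IsDemazureProduct star)
    {K : Set B} (ω : List B) (hω : ∀ k ∈ ω, k ∈ K)
    (hmin : ∀ ω' : List B, (∀ k ∈ ω', k ∈ K) → cs.wordProd ω' = cs.wordProd ω →
      ω.length ≤ ω'.length) : cs.IsReduced ω := by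
  induction hn : ω.length using Nat.strong_induction_on generalizing ω with
  | _ n ih =>
    subst hn
    rcases ω with _ | ⟨i, ω⟩
    · simp [IsReduced]
    have hr : cs.IsReduced ω := by
      refine ih ω.length (by simp) ω (fun k hk ↦ hω k (by simp [hk])) ?_ rfl
      intro ω' h h'
      have := hmin (i :: ω') (by simpa [hω i (by simp)] using h) (by simp [wordProd_cons, h'])
      simpa using this
    rcases List.eq_nil_or_concat ω with rfl | ⟨α, j, rfl⟩
    · simp [IsReduced]
    rw [List.concat_eq_append] at *
    have hl : cs.IsReduced (i :: α) := by
      refine ih (i :: α).length (by simp) (i :: α) (fun k hk ↦ hω k ?_) ?_ rfl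
      · simp only [List.mem_cons, List.mem_append] at *; tauto
      intro ω' h h'
      have := hmin (ω' ++ [j]) ?_ ?_
      · simpa using this
      · intro k hk
        rcases List.mem_append.mp hk with hk | hk
        · exact h k hk
        · exact hω k (by simp_all)
      · rw [wordProd_append, h', ← wordProd_append, List.cons_append]
    apply hr.cons
    by_contra hlt
    have h0 := hl.of_cons.eq
    have h1 := hl.length_lt_of_cons
    have h2 := hr.eq
    have h3 := hl.eq
    rw [wordProd_cons] at h3
    simp only [wordProd_append, wordProd_singleton, List.length_append, List.length_cons,
      List.length_nil, ← mul_assoc] at hlt h2 h3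
    have h4 := cs.length_simple_mul_ne (cs.wordProd α * cs.simple j) i
    rw [← mul_assoc] at h4
    have h5 := cs.length_mul_simple_ne (cs.simple i * cs.wordProd α) j
    have := hs.simple_mul_eq_mul_simple h1 (i := i) (j := j) (by omega) (by omega)
    have h6 := hmin α (fun k hk ↦ hω k (by simp [hk])) (by
      rw [wordProd_cons, wordProd_append, wordProd_singleton, ← this,
        simple_mul_simple_cancel_left])
    simp at h6

theorem exists_isReduced_of_mem_closure (hs : cs.IsDemazureProduct star) {K : Set B} {u : W}
    (hu : u ∈ Subgroup.closure (cs.simple '' K)) :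
    ∃ ω : List B, (∀ k ∈ ω, k ∈ K) ∧ cs.IsReduced ω ∧ u = cs.wordProd ω := by
  have hex : ∃ ω : List B, (∀ k ∈ ω, k ∈ K) ∧ cs.wordProd ω = u := by
    induction hu using Subgroup.closure_induction with
    | mem x hx =>
      obtain ⟨k, hk, rfl⟩ := hx
      exact ⟨[k], by simpa using hk, by simp⟩
    | one => exact ⟨[], by simp⟩
    | mul x y _ _ hx hy =>
      obtain ⟨α, hα, rfl⟩ := hx
      obtain ⟨β, hβ, rfl⟩ := hy
      refine ⟨α ++ β, fun k hk ↦ ?_, wordProd_append ..⟩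
      rcases List.mem_append.mp hk with h | h
      exacts [hα k h, hβ k h]
    | inv x _ hx =>
      obtain ⟨α, hα, rfl⟩ := hx
      exact ⟨α.reverse, by simpa using hα, by simp⟩
  have hex' : ∃ n, ∃ ω : List B, (∀ k ∈ ω, k ∈ K) ∧ cs.wordProd ω = u ∧ ω.length = n := by
    obtain ⟨ω, h, h'⟩ := hex
    exact ⟨_, ω, h, h', rfl⟩
  classical
  obtain ⟨ω, h, h', hn⟩ := Nat.find_spec hex'
  refine ⟨ω, h, hs.isReduced_of_forall_le ω h fun ω' hK hp ↦ ?_, h'.symm⟩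
  rw [hn]
  exact Nat.find_min' hex' ⟨ω', hK, hp.trans h', rfl⟩

/-- Lengths add in the product of an element of a parabolic subgroup with a minimal coset
representative. -/
theorem length_mul_of_mem_closure (hs : cs.IsDemazureProduct star) {K : Set B} {u v : W}
    (hu : u ∈ Subgroup.closure (cs.simple '' K))
    (hv : ∀ k ∈ K, cs.length v < cs.length (cs.simple k * v)) :
    cs.length (u * v) = cs.length u + cs.length v := by
  induction hn : cs.length v generalizing u v with
  | zero =>
    rw [length_eq_zero_iff] at hn
    simp [hn]
  | succ n ih =>
    have hv1 : v ≠ 1 := by rintro rfl; simp at hn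
    obtain ⟨j, hj⟩ := cs.exists_rightDescent_of_ne_one hv1
    rw [isRightDescent_iff] at hj
    obtain ⟨v', rfl⟩ : ∃ v', v = v' * cs.simple j := ⟨v * cs.simple j, by simp⟩
    rw [simple_mul_simple_cancel_right] at hj
    have hv' : ∀ k ∈ K, cs.length v' < cs.length (cs.simple k * v') := by
      intro k hk
      have h1 := hv k hk
      have h2 := cs.length_mul_simple (cs.simple k * v') j
      rw [← mul_assoc] at h1
      have := cs.length_simple_mul_ne v' k
      omega
    have IH := fun {u : W} (hu : u ∈ Subgroup.closure (cs.simple '' K)) ↦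
      ih hu hv' (by omega)
    obtain ⟨ω, hK, hω, rfl⟩ := hs.exists_isReduced_of_mem_closure hu
    have hmem : ∀ ω : List B, (∀ k ∈ ω, k ∈ K) →
        cs.wordProd ω ∈ Subgroup.closure (cs.simple '' K) := by
      intro ω hω
      refine Subgroup.list_prod_mem _ fun x hx ↦ ?_
      obtain ⟨k, hk, rfl⟩ := List.mem_map.mp hx
      exact Subgroup.subset_closure ⟨k, hω k hk, rfl⟩
    clear hu
    induction ω with
    | nil => simp [hn]
    | cons i ω ihω =>
      have hKω : ∀ k ∈ ω, k ∈ K := fun k hk ↦ hK k (by simp [hk])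
      have l1 := ihω hKω hω.of_cons
      have l2 := IH (hmem ω hKω)
      have l3 := IH (hmem (i :: ω) hK)
      have l4 := hω.eq
      have l5 := hω.of_cons.eq
      rw [wordProd_cons] at l3 l4 ⊢
      rw [List.length_cons] at l4
      have l6 := cs.length_mul_simple (cs.simple i * cs.wordProd ω * v') j
      by_contra hne
      have key := hs.simple_mul_eq_mul_simple (w := cs.wordProd ω * v') (i := i) (j := j)
        (by rw [← mul_assoc]; omega) (by rw [mul_assoc]; omega)
        (by simp only [← mul_assoc] at *; omega)
      have hr := (Subgroup.closure (cs.simple '' K)).mul_mem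
        (Subgroup.inv_mem _ (hmem ω hKω)) (hmem (i :: ω) hK)
      have hrv : (cs.wordProd ω)⁻¹ * cs.wordProd (i :: ω) * v' = v' * cs.simple j := by
        rw [wordProd_cons, mul_assoc, mul_assoc, key]; group
      have l7 := IH hr
      rw [hrv] at l7
      obtain ⟨γ, hγK, hγ, hγe⟩ := hs.exists_isReduced_of_mem_closure hr
      rw [hγe] at l7 hrv
      rw [hγ.eq] at l7
      obtain ⟨k, rfl⟩ := List.length_eq_one_iff.mp (show γ.length = 1 by omega)
      have := hv k (hγK k (by simp))
      rw [wordProd_singleton] at hrv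
      rw [← hrv, simple_mul_simple_cancel_left, hrv] at this
      omega

/-- A form of Matsumoto's theorem: a family in a monoid has the same product along any two reduced
words of an element as soon as this holds for reduced words in two letters. -/
theorem prod_map_eq_of_isReduced (hs : cs.IsDemazureProduct star) {N : Type*} [Monoid N] (A : B → N)
    (hA : ∀ (i j : B) (γ δ : List B), i ≠ j → (∀ k ∈ γ, k = i ∨ k = j) →
      (∀ k ∈ δ, k = i ∨ k = j) → cs.IsReduced (i :: γ) → cs.IsReduced (j :: δ) →
      cs.wordProd (i :: γ) = cs.wordProd (j :: δ) →
      ((i :: γ).map A).prod = ((j :: δ).map A).prod)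
    {α β : List B} (hα : cs.IsReduced α) (hβ : cs.IsReduced β)
    (h : cs.wordProd α = cs.wordProd β) : (α.map A).prod = (β.map A).prod := by
  induction hn : α.length using Nat.strong_induction_on generalizing α β with
  | _ n ih =>
    have hlen : α.length = β.length := by rw [← hα.eq, h, hβ.eq]
    rcases α with _ | ⟨i, α⟩
    · rw [List.length_eq_zero_iff.mp hlen.symm]
    rcases β with _ | ⟨j, β⟩
    · simp at hlen
    simp only [List.length_cons] at hn hlen
    by_cases hij : i = j
    · subst hij
      rw [wordProd_cons, wordProd_cons, mul_left_cancel_iff] at h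
      simp only [List.map_cons, List.prod_cons]
      rw [ih α.length (by omega) hα.of_cons hβ.of_cons h rfl]
    obtain ⟨u, hu, v, huv, hv⟩ := cs.exists_mul_minimal {i, j} (cs.wordProd (i :: α))
    obtain ⟨ν, hν, rfl⟩ := cs.exists_isReduced v
    -- A first letter of a reduced word can be moved to the front of a reduced word of `u`.
    have step : ∀ (k : B) (ζ : List B), k = i ∨ k = j → cs.IsReduced (k :: ζ) →
        cs.wordProd (k :: ζ) = u * cs.wordProd ν → ζ.length < n →
        ∃ γ : List B, (∀ k ∈ γ, k = i ∨ k = j) ∧ cs.IsReduced (k :: γ) ∧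
          cs.wordProd (k :: γ) = u ∧ (ζ.map A).prod = (γ.map A).prod * (ν.map A).prod := by
      intro k ζ hk hζ hζu hζn
      have hku := mul_mem (Subgroup.subset_closure ⟨k, hk, rfl⟩ :
        cs.simple k ∈ Subgroup.closure (cs.simple '' {i, j})) hu
      obtain ⟨γ, hγK, hγ, hγe⟩ := hs.exists_isReduced_of_mem_closure hku
      have e1 : cs.simple k * cs.wordProd γ = u := by
        rw [← hγe, simple_mul_simple_cancel_left]
      have e2 : cs.wordProd ζ = cs.wordProd γ * cs.wordProd ν := by
        rw [← hγe, mul_assoc, ← hζu, wordProd_cons, simple_mul_simple_cancel_left]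
      have l1 := hs.length_mul_of_mem_closure hu hv
      have l2 := hs.length_mul_of_mem_closure hku hv
      have l3 := hζ.length_lt_of_cons
      rw [← wordProd_cons, hζu, e2, ← hγe] at l3
      refine ⟨γ, hγK, hγ.cons ?_, by rw [wordProd_cons, e1], ?_⟩
      · rw [e1, ← hγe]; omega
      · rw [← List.prod_append, ← List.map_append]
        refine ih _ hζn hζ.of_cons ?_ (by rw [e2, wordProd_append]) rfl
        rw [IsReduced, wordProd_append, List.length_append, ← hγ.eq, ← hν.eq, ← hγe, l2]
    obtain ⟨γ, hγ, hγr, hγu, hγA⟩ := step i α (.inl rfl) hα huv (by omega)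
    obtain ⟨δ, hδ, hδr, hδu, hδA⟩ := step j β (.inr rfl) hβ (by rw [← h, huv]) (by omega)
    have := hA i j γ δ hij hγ hδ hγr hδr (by rw [hγu, hδu])
    simp only [List.map_cons, List.prod_cons] at this ⊢
    rw [hγA, hδA, ← mul_assoc, ← mul_assoc, this]

/-- The operator on `W` by which the generator `sᵢ` acts through the projection onto `W_J`. -/
def projOp (_ : cs.IsDemazureProduct star) (J : Set B) [DecidablePred (· ∈ J)] (i : B) :
    Function.End W :=
  if i ∈ J then star (cs.simple i) else id

variable {J : Set B} [DecidablePred (· ∈ J)]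

theorem projOp_of_mem (hs : cs.IsDemazureProduct star)
    {i : B} (hi : i ∈ J) : hs.projOp J i = star (cs.simple i) := if_pos hi

theorem projOp_of_notMem (hs : cs.IsDemazureProduct star)
    {i : B} (hi : i ∉ J) : hs.projOp J i = 1 := if_neg hi

theorem projOp_mul_self (hs : cs.IsDemazureProduct star)
    (i : B) : hs.projOp J i * hs.projOp J i = hs.projOp J i := by
  by_cases hi : i ∈ J
  · rw [hs.projOp_of_mem hi]
    funext x
    change star _ (star _ x) = star _ x
    rw [← hs.assoc, hs.simple_star_self]
  · rw [hs.projOp_of_notMem hi, mul_one]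

theorem prod_map_projOp_of_subset (hs : cs.IsDemazureProduct star)
    {ω : List B} (hω : cs.IsReduced ω) (hJ : ∀ k ∈ ω, k ∈ J) :
    (ω.map (hs.projOp J)).prod = star (cs.wordProd ω) := by
  induction ω with
  | nil => exact funext fun x ↦ (hs.one_star x).symm
  | cons i ω ih =>
    rw [List.map_cons, List.prod_cons, ih hω.of_cons fun k hk ↦ hJ k (by simp [hk]),
      hs.projOp_of_mem (hJ i (by simp))]
    funext x
    change star _ (star _ x) = star _ x
    rw [← hs.assoc, hs.simple_star_of_lt i _ hω.length_lt_of_cons, wordProd_cons]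

theorem prod_map_projOp_eq_projOp (hs : cs.IsDemazureProduct star)
    {i j : B} (hj : j ∉ J) {ω : List B} (hi : i ∈ ω)
    (hω : ∀ k ∈ ω, k = i ∨ k = j) : (ω.map (hs.projOp J)).prod = hs.projOp J i := by
  have key : ∀ ω : List B, (∀ k ∈ ω, k = i ∨ k = j) →
      hs.projOp J i * (ω.map (hs.projOp J)).prod = hs.projOp J i := by
    intro ω hω
    induction ω with
    | nil => simp
    | cons k ω ih =>
      have := ih fun l hl ↦ hω l (by simp [hl])
      rw [List.map_cons, List.prod_cons, ← mul_assoc]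
      rcases hω k (by simp) with rfl | rfl
      · rw [hs.projOp_mul_self, this]
      · rw [hs.projOp_of_notMem hj, mul_one, this]
  induction ω with
  | nil => simp at hi
  | cons k ω ih =>
    have hω' : ∀ l ∈ ω, l = i ∨ l = j := fun l hl ↦ hω l (by simp [hl])
    rw [List.map_cons, List.prod_cons]
    rcases hω k (by simp) with rfl | rfl
    · exact key ω hω'
    · rw [hs.projOp_of_notMem hj, one_mul]
      rcases List.mem_cons.mp hi with rfl | hi
      · simpa [hs.projOp_of_notMem hj] using key ω hω'
      · exact ih hi hω'

theorem prod_map_projOp_eq (hs : cs.IsDemazureProduct star)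
    {α β : List B} (hα : cs.IsReduced α) (hβ : cs.IsReduced β)
    (h : cs.wordProd α = cs.wordProd β) :
    (α.map (hs.projOp J)).prod = (β.map (hs.projOp J)).prod := by
  refine hs.prod_map_eq_of_isReduced _ ?_ hα hβ h
  intro i j γ δ hij hγ hδ hγr hδr h
  have hiδ := IsReduced.mem_of_wordProd_cons_eq_cons hij hδ hγr hδr h
  have hjγ := IsReduced.mem_of_wordProd_cons_eq_cons hij.symm (fun k hk ↦ (hγ k hk).symm)
    hδr hγr h.symm
  have hγ' : ∀ k ∈ i :: γ, k = i ∨ k = j := by simpa using hγ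
  have hδ' : ∀ k ∈ j :: δ, k = i ∨ k = j := by simpa using hδ
  by_cases hi : i ∈ J
  · by_cases hj : j ∈ J
    · have hJ : ∀ k, k = i ∨ k = j → k ∈ J := by rintro k (rfl | rfl) <;> assumption
      rw [hs.prod_map_projOp_of_subset hγr fun k hk ↦ hJ k (hγ' k hk),
        hs.prod_map_projOp_of_subset hδr fun k hk ↦ hJ k (hδ' k hk), h]
    · rw [hs.prod_map_projOp_eq_projOp hj (by simp) hγ',
        hs.prod_map_projOp_eq_projOp hj (by simp [hiδ]) hδ']
  · rw [hs.prod_map_projOp_eq_projOp hi (i := j) (by simp [hjγ]) fun k hk ↦ (hγ' k hk).symm,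
      hs.prod_map_projOp_eq_projOp hi (i := j) (by simp) fun k hk ↦ (hδ' k hk).symm]

/-- The projection of `(W, *)` onto the parabolic submonoid `(W_J, *)`. -/
noncomputable def proj (hs : cs.IsDemazureProduct star) (J : Set B) [DecidablePred (· ∈ J)]
    (w : W) : W :=
  ((cs.exists_isReduced w).choose.map (hs.projOp J)).prod 1

theorem proj_wordProd (hs : cs.IsDemazureProduct star) {ω : List B} (hω : cs.IsReduced ω) :
    hs.proj J (cs.wordProd ω) = (ω.map (hs.projOp J)).prod 1 := by
  have h := (cs.exists_isReduced (cs.wordProd ω)).choose_spec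
  exact congrFun (hs.prod_map_projOp_eq h.1 hω h.2.symm) 1

theorem proj_one (hs : cs.IsDemazureProduct star) : hs.proj J 1 = 1 := by
  simpa using! hs.proj_wordProd (J := J) (ω := []) (by simp [IsReduced])

theorem proj_simple (hs : cs.IsDemazureProduct star)
    (i : B) : hs.proj J (cs.simple i) = hs.projOp J i 1 := by
  simpa using! hs.proj_wordProd (J := J) (ω := [i]) (by simp [IsReduced])

theorem proj_simple_star (hs : cs.IsDemazureProduct star) (i : B) (w : W) :
    hs.proj J (star (cs.simple i) w) = hs.projOp J i (hs.proj J w) := by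
  have up : ∀ w : W, cs.length w < cs.length (cs.simple i * w) →
      hs.proj J (cs.simple i * w) = hs.projOp J i (hs.proj J w) := by
    intro w hw
    obtain ⟨ω, hω, rfl⟩ := cs.exists_isReduced w
    rw [← wordProd_cons, hs.proj_wordProd (hω.cons hw), hs.proj_wordProd hω, List.map_cons,
      List.prod_cons]
    rfl
  rcases (cs.length_simple_mul_ne w i).lt_or_gt with h | h
  · rw [hs.simple_star_of_gt i w h]
    have := up (cs.simple i * w) (by simpa using h)
    rw [simple_mul_simple_cancel_left] at this
    rw [this]
    exact (congrFun (hs.projOp_mul_self i) _).symm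
  · rw [hs.simple_star_of_lt i w h, up w h]

theorem projOp_star (hs : cs.IsDemazureProduct star) (i : B) (x y : W) :
    hs.projOp J i (star x y) = star (hs.projOp J i x) y := by
  by_cases hi : i ∈ J
  · rw [hs.projOp_of_mem hi, hs.assoc]
  · rw [hs.projOp_of_notMem hi]
    rfl

theorem proj_star (hs : cs.IsDemazureProduct star)
    (w w' : W) : hs.proj J (star w w') = star (hs.proj J w) (hs.proj J w') := by
  obtain ⟨ω, hω, rfl⟩ := cs.exists_isReduced w
  induction ω with
  | nil => rw [wordProd_nil, hs.proj_one, hs.one_star, hs.one_star]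
  | cons i ω ih =>
    rw [wordProd_cons, ← hs.simple_star_of_lt i _ hω.length_lt_of_cons, hs.assoc,
      hs.proj_simple_star, ih hω.of_cons, hs.projOp_star, hs.proj_simple_star]

theorem proj_mem_closure (hs : cs.IsDemazureProduct star)
    (w : W) : hs.proj J w ∈ Subgroup.closure (cs.simple '' J) := by
  obtain ⟨ω, hω, rfl⟩ := cs.exists_isReduced w
  induction ω with
  | nil => rw [wordProd_nil, hs.proj_one]; exact one_mem _
  | cons i ω ih =>
    rw [wordProd_cons, ← hs.simple_star_of_lt i _ hω.length_lt_of_cons, hs.proj_simple_star]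
    have hx := ih hω.of_cons
    generalize hs.proj J (cs.wordProd ω) = x at *
    by_cases hi : i ∈ J
    · rw [hs.projOp_of_mem hi]
      rcases (cs.length_simple_mul_ne x i).lt_or_gt with h | h
      · rwa [hs.simple_star_of_gt i x h]
      · rw [hs.simple_star_of_lt i x h]
        exact mul_mem (Subgroup.subset_closure ⟨i, hi, rfl⟩) hx
    · rw [hs.projOp_of_notMem hi]
      exact hx

end IsDemazureProduct

end CoxeterSystem

/-- For a Coxeter system `(W, S)` with Demazure product `*` and `J ⊂ I`, the map
`π_J` sending `s_i ↦ s_i` for `i ∈ J` and `s_i ↦ 1` for `i ∉ J` extends to a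
well-defined morphism of monoids `(W, *) → (W_J, *)`. -/
theorem stmt4 {B W : Type*} [Group W] {M : CoxeterMatrix B}
    (cs : CoxeterSystem M W)
    (star : W → W → W)
    (hassoc : ∀ u v w : W, star (star u v) w = star u (star v w))
    (hone : ∀ w : W, star 1 w = w ∧ star w 1 = w)
    (hgen₁ : ∀ (i : B) (w : W), cs.length w < cs.length (cs.simple i * w) →
      star (cs.simple i) w = cs.simple i * w)
    (hgen₂ : ∀ (i : B) (w : W), cs.length (cs.simple i * w) < cs.length w →
      star (cs.simple i) w = w)
    (J : Set B) :
    ∃ f : W → W,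
      (∀ w : W, f w ∈ Subgroup.closure (cs.simple '' J)) ∧
      f 1 = 1 ∧
      (∀ i ∈ J, f (cs.simple i) = cs.simple i) ∧
      (∀ i ∉ J, f (cs.simple i) = 1) ∧
      (∀ w w' : W, f (star w w') = star (f w) (f w')) := by
  classical
  have hs : cs.IsDemazureProduct star :=
    ⟨hassoc, fun w ↦ (hone w).1, fun w ↦ (hone w).2, hgen₁, hgen₂⟩
  refine ⟨hs.proj J, hs.proj_mem_closure, hs.proj_one, fun i hi ↦ ?_, fun i hi ↦ ?_, hs.proj_star⟩
  · rw [hs.proj_simple, hs.projOp_of_mem hi, hs.star_one]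
  · rw [hs.proj_simple, hs.projOp_of_notMem hi]
    rfl
end

section
/- Let $g \in GL_n(\mathbb{R})$ be a matrix all of whose minors (of all sizes) are strictly positive. Then $g$ has $n$ distinct eigenvalues, all of which are real and strictly positive. -/
open Polynomial

namespace Matrix

/-- The Desnanot–Jacobi identity. -/
theorem adjugate_mul_sub_adjugate_mul_eq {R : Type*} [CommRing R] [IsDomain R] {n : ℕ}
    (M : Matrix (Fin (n + 2)) (Fin (n + 2)) R) (hM : M.det ≠ 0) :
    M.adjugate 0 0 * M.adjugate (Fin.last _) (Fin.last _) -
      M.adjugate 0 (Fin.last _) * M.adjugate (Fin.last _) 0 =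
    M.det * (M.submatrix (fun i : Fin n => i.castSucc.succ) (fun i => i.castSucc.succ)).det := by
  set u : Fin (n + 2) → R := fun i => M.adjugate i 0 with hu
  set v : Fin (n + 2) → R := fun i => M.adjugate i (Fin.last _) with hv
  set N : Matrix (Fin (n + 2)) (Fin (n + 2)) R :=
    ((1 : Matrix (Fin (n + 2)) (Fin (n + 2)) R).updateCol 0 u).updateCol (Fin.last _) v with hN
  have h0l : (0 : Fin (n + 2)) ≠ Fin.last _ := by simp [Fin.ext_iff]
  have hNdet : N.det = u 0 * v (Fin.last _) - v 0 * u (Fin.last _) := by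
    let U : Matrix (Fin (n + 2)) (Fin 2) R :=
      .of fun i => ![u i - (1 : Matrix (Fin (n + 2)) (Fin (n + 2)) R) i 0, v i - (1 : Matrix (Fin (n + 2)) (Fin (n + 2)) R) i (Fin.last _)]
    let V : Matrix (Fin 2) (Fin (n + 2)) R :=
      .of ![Pi.single 0 1, Pi.single (Fin.last _) 1]
    have : N = 1 + U * V := by
      ext i j
      simp only [hN, updateCol_apply, add_apply, mul_apply, Fin.sum_univ_two, U, V, of_apply]
      by_cases hj : j = Fin.last _
      · subst hj; simp [h0l.symm]
      · by_cases hj0 : j = 0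
        · subst hj0; simp [h0l]
        · simp [hj, hj0]
    rw [this, det_one_add_mul_comm, det_fin_two]
    simp only [add_apply, mul_apply, U, V, of_apply]
    simp [Pi.single_apply, h0l, h0l.symm]
  have hMN : M * N = ((M.updateCol 0 (M.det • Pi.single 0 1)).updateCol (Fin.last _)
      (M.det • Pi.single (Fin.last _) 1)) := by
    have key : ∀ i j, ∑ k, M i k * M.adjugate k j = (M.det • (1 : Matrix (Fin (n + 2)) (Fin (n + 2)) R)) i j := by
      intro i j; rw [← mul_adjugate, mul_apply]
    ext i j
    simp only [hN, updateCol_apply, mul_apply]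
    by_cases hj : j = Fin.last _
    · simp [hj, hv, key, one_apply, Pi.single_apply]
    · by_cases hj0 : j = 0
      · simp [hj0, h0l, hu, key, one_apply, Pi.single_apply]
      · simp [hj, hj0, one_apply]
  have hdet : (M * N).det = M.det * (M.det *
      (M.submatrix (fun i : Fin n => i.castSucc.succ) (fun i => i.castSucc.succ)).det) := by
    rw [hMN, det_updateCol_smul, updateCol_comm _ h0l, det_updateCol_smul]
    congr 2
    rw [det_succ_column_zero, Fin.sum_univ_succ]
    simp only [updateCol_apply, Pi.single_apply, Fin.succ_ne_zero, if_false, mul_zero, zero_mul,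
      Finset.sum_const_zero, add_zero, if_true, mul_one]
    rw [det_succ_column _ (Fin.last _), Fin.sum_univ_castSucc]
    simp only [submatrix_apply, updateCol_apply, Fin.succ_ne_zero, if_false, Fin.zero_succAbove,
      Fin.succ_last, if_true, Pi.single_apply]
    simp [Fin.succ_castSucc, Fin.castSucc_ne_last, -Fin.castSucc_succ]
    congr 1
    ext i j
    simp [Fin.succ_castSucc, Fin.castSucc_ne_last, -Fin.castSucc_succ]
  rw [det_mul, hNdet] at hdet
  exact mul_left_cancel₀ hM hdet

/-- All minors are positive. -/
def IsTotallyPositive {m n : ℕ} (A : Matrix (Fin m) (Fin n) ℝ) : Prop :=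
  ∀ (k : ℕ) (r : Fin k → Fin m) (c : Fin k → Fin n), StrictMono r → StrictMono c →
    0 < (A.submatrix r c).det

theorem IsTotallyPositive.submatrix {m n m' n' : ℕ} {A : Matrix (Fin m) (Fin n) ℝ}
    (hA : A.IsTotallyPositive) {r : Fin m' → Fin m} {c : Fin n' → Fin n}
    (hr : StrictMono r) (hc : StrictMono c) : (A.submatrix r c).IsTotallyPositive :=
  fun k r' c' hr' hc' => by simpa using hA k _ _ (hr.comp hr') (hc.comp hc')

theorem IsTotallyPositive.transpose {m n : ℕ} {A : Matrix (Fin m) (Fin n) ℝ}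
    (hA : A.IsTotallyPositive) : Aᵀ.IsTotallyPositive := fun k r c hr hc => by
  rw [← det_transpose]; simpa using hA k c r hc hr

theorem IsTotallyPositive.det_pos {n : ℕ} {A : Matrix (Fin n) (Fin n) ℝ}
    (hA : A.IsTotallyPositive) : 0 < A.det := by
  simpa using hA n id id strictMono_id strictMono_id

/-- Subtracting a nonnegative constant along an initial stretch of the subdiagonal of a totally
positive matrix keeps the determinant positive. -/
theorem IsTotallyPositive.det_sub_subdiagonal_pos {x : ℝ} (hx : 0 ≤ x) (k : ℕ) {m : ℕ}
    {B : Matrix (Fin m) (Fin m) ℝ} (hB : B.IsTotallyPositive) :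
    0 < (B - .of fun i j : Fin m => if i.val = j.val + 1 ∧ j.val < k then x else 0).det := by
  induction k generalizing m with
  | zero =>
    convert hB.det_pos using 2
    ext i j
    simp
  | succ k ih =>
    by_cases hk : k + 1 < m
    · obtain ⟨m, rfl⟩ : ∃ l, m = l + 1 := ⟨m - 1, by omega⟩
      set r : Fin (m + 1) := ⟨k + 1, hk⟩ with hr
      set c : Fin (m + 1) := ⟨k, by omega⟩ with hc
      set P := B - .of fun i j : Fin (m + 1) => if i.val = j.val + 1 ∧ j.val < k then x else 0
        with hP
      have h1 : (B - .of fun i j : Fin (m + 1) => if i.val = j.val + 1 ∧ j.val < k + 1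
          then x else 0) = P.updateRow r (P r + (-x) • Pi.single c 1) := by
        ext i j
        simp only [hP, updateRow_apply, sub_apply, of_apply, Pi.add_apply, Pi.smul_apply,
          Pi.single_apply, hr, hc, Fin.ext_iff, smul_eq_mul]
        split_ifs <;> grind
      have h2 : P.submatrix r.succAbove c.succAbove =
          B.submatrix r.succAbove c.succAbove -
            .of fun i j : Fin m => if i.val = j.val + 1 ∧ j.val < k then x else 0 := by
        ext i j
        simp only [hP, submatrix_apply, sub_apply, of_apply, hr, hc, Fin.succAbove,
          Fin.lt_def, Fin.val_castSucc]
        congr 2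
        split_ifs <;> simp <;> omega
      rw [h1, det_updateRow_add, det_updateRow_smul, updateRow_eq_self, ← adjugate_apply,
        adjugate_fin_succ_eq_det_submatrix, h2]
      have := ih hB
      have := ih (hB.submatrix (Fin.strictMono_succAbove r) (Fin.strictMono_succAbove c))
      have hs : (-1 : ℝ) ^ ((r : ℕ) + c) = -1 := by
        exact Odd.neg_one_pow ⟨k, by simp [hr, hc]; ring⟩
      rw [hs]
      nlinarith
    · convert ih hB using 5 with i j
      ext j
      have := i.2; have := j.2
      congr 1
      simp
      omega

theorem IsTotallyPositive.adjugate_zero_last_pos {x : ℝ} (hx : 0 ≤ x) {n : ℕ}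
    {A : Matrix (Fin (n + 1)) (Fin (n + 1)) ℝ} (hA : A.IsTotallyPositive) :
    0 < (scalar _ x - A).adjugate 0 (Fin.last n) := by
  have := (hA.submatrix (Fin.strictMono_castSucc (n := n))
    (Fin.strictMono_succ)).det_sub_subdiagonal_pos hx n
  rw [adjugate_fin_succ_eq_det_submatrix]
  have h : (scalar (Fin (n + 1)) x - A).submatrix (Fin.last n).succAbove (Fin.succAbove 0) =
      -(A.submatrix Fin.castSucc Fin.succ -
        .of fun i j : Fin n => if i.val = j.val + 1 ∧ j.val < n then x else 0) := by
    ext i j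
    simp [diagonal_apply, Fin.ext_iff]
  rw [h, det_neg]
  simpa [← mul_assoc, ← mul_pow] using this

theorem IsTotallyPositive.adjugate_last_zero_pos {x : ℝ} (hx : 0 ≤ x) {n : ℕ}
    {A : Matrix (Fin (n + 1)) (Fin (n + 1)) ℝ} (hA : A.IsTotallyPositive) :
    0 < (scalar _ x - A).adjugate (Fin.last n) 0 := by
  have := hA.transpose.adjugate_zero_last_pos hx
  rwa [show scalar _ x - Aᵀ = (scalar _ x - A)ᵀ by simp, ← adjugate_transpose] at this

theorem IsTotallyPositive.charpoly_mul_lt {x : ℝ} (hx : 0 ≤ x) {n : ℕ}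
    {A : Matrix (Fin (n + 2)) (Fin (n + 2)) ℝ} (hA : A.IsTotallyPositive) :
    A.charpoly.eval x *
      (A.submatrix (fun i : Fin n => i.castSucc.succ) (fun i => i.castSucc.succ)).charpoly.eval x <
    (A.submatrix Fin.succ Fin.succ).charpoly.eval x *
      (A.submatrix Fin.castSucc Fin.castSucc).charpoly.eval x := by
  have h := adjugate_mul_sub_adjugate_mul_eq A.charmatrix A.charpoly_monic.ne_zero
  have h := congr_arg (evalRingHom x) h
  have hm : (evalRingHom x).mapMatrix A.charmatrix = scalar _ x - A := by
    ext i j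
    by_cases hij : i = j
    · subst hij; simp
    · simp [hij]
  have hmap : ∀ i j, evalRingHom x (A.charmatrix.adjugate i j) =
      (scalar _ x - A).adjugate i j := by
    intro i j
    rw [← hm, ← RingHom.map_adjugate]; rfl
  simp only [map_sub, map_mul, hmap] at h
  have hsub : ∀ {m : ℕ} (f : Fin m → Fin (n + 2)), Function.Injective f →
      A.charmatrix.submatrix f f = (A.submatrix f f).charmatrix := by
    intro m f hf
    ext i j : 2
    simp [charmatrix_apply, diagonal_apply, hf.eq_iff]
  have hadj : ∀ i, (scalar _ x - A).adjugate i i =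
      (A.submatrix i.succAbove i.succAbove).charpoly.eval x := by
    intro i
    rw [eval_charpoly, adjugate_fin_succ_eq_det_submatrix, (Even.add_self _).neg_one_pow, one_mul]
    congr 1
    ext a b
    simp [diagonal_apply]
  rw [hsub (fun i => i.castSucc.succ) ((Fin.succ_injective _).comp (Fin.castSucc_injective _)), hadj, hadj] at h
  have h1 := mul_pos (hA.adjugate_zero_last_pos hx) (hA.adjugate_last_zero_pos hx)
  change _ = A.charpoly.eval x * eval x (charpoly _) at h
  rw [← h]
  rw [show (0 : Fin (n + 2)).succAbove = Fin.succ from funext Fin.zero_succAbove,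
    show (Fin.last (n + 1)).succAbove = Fin.castSucc from funext Fin.succAbove_last_apply]
  linarith

end Matrix

/-- A monic polynomial of degree `n` with alternating signs at `n + 1` points splits, with one root
in each gap. -/
theorem Polynomial.exists_eq_prod_X_sub_C_of_alternating {n : ℕ} {p : ℝ[X]} (hp : p.Monic)
    (hdeg : p.natDegree = n) {e : Fin (n + 1) → ℝ} (he : StrictMono e)
    (hsign : ∀ i : Fin (n + 1), 0 < (-1) ^ (n - i.val) * p.eval (e i)) :
    ∃ lam : Fin n → ℝ, (∀ i, e i.castSucc < lam i ∧ lam i < e i.succ) ∧ StrictMono lam ∧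
      p = ∏ i, (X - C (lam i)) := by
  have hroot : ∀ i : Fin n, ∃ y, (e i.castSucc < y ∧ y < e i.succ) ∧ p.eval y = 0 := by
    intro i
    have h1 := hsign i.castSucc
    have h2 := hsign i.succ
    set s : ℝ := (-1) ^ (n - i.succ.val) with hs
    have hpow : (-1 : ℝ) ^ (n - i.castSucc.val) = -s := by
      rw [show n - i.castSucc.val = (n - i.succ.val) + 1 by simp; omega, pow_succ]; ring
    rw [hpow] at h1
    have hc : ContinuousOn (fun y => s * p.eval y) (Set.Icc (e i.castSucc) (e i.succ)) := by
      fun_prop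
    obtain ⟨y, hy, hy0⟩ := intermediate_value_Ioo (he i.castSucc_lt_succ).le hc
      (show (0 : ℝ) ∈ Set.Ioo _ _ from ⟨by linarith, h2⟩)
    exact ⟨y, hy, (mul_eq_zero.mp hy0).resolve_left (by simp [hs])⟩
  choose lam hlam h0 using hroot
  have hmono : StrictMono lam := fun i j hij =>
    (hlam i).2.trans_le ((he.monotone (Fin.succ_le_castSucc_iff.mpr hij)).trans (hlam j).1.le)
  refine ⟨lam, hlam, hmono, ?_⟩
  refine eq_of_monic_of_dvd_of_natDegree_le (monic_prod_X_sub_C lam _) hp ?_ ?_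
  · exact Fintype.prod_dvd_of_coprime (pairwise_coprime_X_sub_C hmono.injective)
      fun i => dvd_iff_isRoot.mpr (h0 i)
  · rw [hdeg]; simp

theorem prod_sub_sign_pos {n : ℕ} {lam : Fin (n + 1) → ℝ} {mu : Fin n → ℝ}
    (h : ∀ i, lam i.castSucc < mu i ∧ mu i < lam i.succ) (hlam : StrictMono lam)
    (i : Fin (n + 1)) : 0 < (-1) ^ (n - i.val) * ∏ j, (lam i - mu j) := by
  have hcard : (Finset.univ.filter fun j : Fin n => ¬ j.castSucc < i).card = n - i.val := by
    have h1 := Finset.card_filter_add_card_filter_not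
      (s := (Finset.univ : Finset (Fin n))) (fun j : Fin n => j.val < i.val)
    rw [Fin.card_filter_val_lt] at h1
    simp only [Fin.lt_def, Fin.val_castSucc]
    have := i.2
    simp at h1
    simp
    omega
  have hprod : (-1 : ℝ) ^ (n - i.val) = ∏ j : Fin n, if j.castSucc < i then 1 else -1 := by
    rw [Finset.prod_ite, hcard.symm]; simp
  rw [hprod, ← Finset.prod_mul_distrib]
  refine Finset.prod_pos fun j _ => ?_
  split_ifs with hj
  · have := hlam.monotone (Fin.castSucc_lt_iff_succ_le.mp hj)
    linarith [(h j).2]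
  · have := hlam.monotone (not_lt.mp hj)
    linarith [(h j).1]

theorem Polynomial.exists_interlacing {n : ℕ} {p : ℝ[X]} (hp : p.Monic)
    (hdeg : p.natDegree = n + 1) {mu : Fin n → ℝ} (hmu : StrictMono mu) (hpos : ∀ i, 0 < mu i)
    (h0 : 0 < (-1) ^ (n + 1) * p.eval 0)
    (hsign : ∀ i : Fin n, 0 < (-1) ^ (n - i.val) * p.eval (mu i)) :
    ∃ lam : Fin (n + 1) → ℝ, StrictMono lam ∧ (∀ i, 0 < lam i) ∧
      p = ∏ i, (X - C (lam i)) ∧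
      ∀ i : Fin (n + 1), 0 < (-1) ^ (n - i.val) * (∏ j, (X - C (mu j))).eval (lam i) := by
  have htend := p.tendsto_atTop_of_leadingCoeff_nonneg
    (natDegree_pos_iff_degree_pos.mp (by omega)) (by simp [hp.leadingCoeff])
  obtain ⟨T, hTp, hT0, hTmu⟩ := ((htend.eventually_gt_atTop 0).and
    ((Filter.eventually_gt_atTop (0 : ℝ)).and
      (Filter.eventually_all.mpr fun i : Fin n => Filter.eventually_gt_atTop (mu i)))).exists
  let e : Fin (n + 2) → ℝ := Fin.cons 0 (Fin.snoc mu T : Fin (n + 1) → ℝ)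
  have he_mu : ∀ i : Fin n, e i.castSucc.succ = mu i := fun i => by simp [e, -Fin.castSucc_succ]
  have he_T : e (Fin.last n).succ = T := by simp [e, -Fin.succ_last]
  have he : StrictMono e := by
    have hs : StrictMono (Fin.snoc mu T : Fin (n + 1) → ℝ) := by
      intro i j hij
      cases j using Fin.lastCases with
      | last =>
        cases i using Fin.lastCases with
        | last => exact absurd hij (lt_irrefl _)
        | cast i => simpa using hTmu i
      | cast j =>
        cases i using Fin.lastCases with
        | last => exact absurd hij (Fin.castSucc_lt_last j).asymm
        | cast i => simpa using hmu (by simpa using hij)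
    have hs0 : ∀ i, 0 < (Fin.snoc mu T : Fin (n + 1) → ℝ) i := by
      intro i
      cases i using Fin.lastCases with
      | last => simpa using hT0
      | cast i => simpa using hpos i
    intro i j hij
    cases j using Fin.cases with
    | zero => exact absurd hij (Fin.not_lt_zero i)
    | succ j =>
      cases i using Fin.cases with
      | zero => simpa [e] using hs0 j
      | succ i => simpa [e] using hs (by simpa using hij)
  obtain ⟨lam, hlam, hmono, hprod⟩ :=
    exists_eq_prod_X_sub_C_of_alternating hp hdeg he fun i => by
      cases i using Fin.cases with
      | zero => simpa [e] using h0
      | succ i =>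
        cases i using Fin.lastCases with
        | last => rw [he_T]; simpa using hTp
        | cast i => rw [he_mu]; simpa using hsign i
  have hbetween : ∀ i : Fin n, lam i.castSucc < mu i ∧ mu i < lam i.succ := fun i => by
    rw [← he_mu]
    exact ⟨(hlam i.castSucc).2, by
      simpa [-Fin.castSucc_succ, Fin.succ_castSucc] using (hlam i.succ).1⟩
  refine ⟨lam, hmono, fun i => ?_, hprod, fun i => ?_⟩
  · exact (he.monotone (Fin.zero_le i.castSucc)).trans_lt (hlam i).1
  · simpa [eval_prod] using prod_sub_sign_pos hbetween hmono i

/-- The eigenvalues of a totally positive matrix are real, positive and distinct, and strictly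
interlace those of the submatrix with the first or the last row and column removed. -/
theorem Matrix.IsTotallyPositive.charpoly_interlaces {n : ℕ}
    {A : Matrix (Fin (n + 1)) (Fin (n + 1)) ℝ} (hA : A.IsTotallyPositive)
    {f : Fin n → Fin (n + 1)} (hf : f = Fin.succ ∨ f = Fin.castSucc) :
    ∃ lam : Fin (n + 1) → ℝ, StrictMono lam ∧ (∀ i, 0 < lam i) ∧
      A.charpoly = ∏ i, (X - C (lam i)) ∧
      ∀ i : Fin (n + 1), 0 < (-1) ^ (n - i.val) * (A.submatrix f f).charpoly.eval (lam i) := by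
  have h0 : 0 < (-1) ^ (n + 1) * A.charpoly.eval 0 := by
    rw [← coeff_zero_eq_eval_zero]
    simpa [det_eq_sign_charpoly_coeff] using hA.det_pos
  have hdeg : A.charpoly.natDegree = n + 1 := by simp [charpoly_natDegree_eq_dim]
  induction n with
  | zero =>
    obtain ⟨lam, hmono, hpos, hprod, -⟩ := exists_interlacing (mu := Fin.elim0)
      A.charpoly_monic hdeg (fun i => i.elim0) (fun i => i.elim0) h0 (fun i => i.elim0)
    exact ⟨lam, hmono, hpos, hprod, fun i => by simp [charpoly_isEmpty]⟩
  | succ n ih =>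
    obtain ⟨g, hg, hfg, hlt⟩ : ∃ g : Fin n → Fin (n + 1), (g = Fin.succ ∨ g = Fin.castSucc) ∧
        StrictMono f ∧ ∀ x : ℝ, 0 ≤ x → (A.submatrix f f).charpoly.eval x = 0 →
          A.charpoly.eval x * ((A.submatrix f f).submatrix g g).charpoly.eval x < 0 := by
      rcases hf with rfl | rfl
      · refine ⟨Fin.castSucc, .inr rfl, Fin.strictMono_succ, fun x hx hroot => ?_⟩
        simpa [hroot, Function.comp_def, -Fin.castSucc_succ] using hA.charpoly_mul_lt hx
      · refine ⟨Fin.succ, .inl rfl, Fin.strictMono_castSucc, fun x hx hroot => ?_⟩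
        simpa [hroot, Function.comp_def] using hA.charpoly_mul_lt hx
    have hB := hA.submatrix hfg hfg
    obtain ⟨mu, hmu, hmupos, hmuprod, hmusign⟩ := ih hB hg
      (by rw [← coeff_zero_eq_eval_zero]
          simpa [det_eq_sign_charpoly_coeff] using hB.det_pos)
      (by simp [charpoly_natDegree_eq_dim])
    rw [hmuprod]
    refine exists_interlacing A.charpoly_monic hdeg hmu hmupos h0 fun i => ?_
    have h1 := hlt (mu i) (hmupos i).le (by
      rw [hmuprod, eval_prod]
      exact Finset.prod_eq_zero (Finset.mem_univ i) (by simp))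
    have h2 := hmusign i
    rw [show n + 1 - i.val = n - i.val + 1 by omega, pow_succ]
    rcases neg_one_pow_eq_or ℝ (n - i.val) with hs | hs <;> rw [hs] at h2 ⊢ <;> nlinarith

/-- Gantmacher–Krein: a real matrix all of whose minors (of all sizes) are
strictly positive has `n` distinct real strictly positive eigenvalues, i.e. its
characteristic polynomial splits over `ℝ` with distinct positive roots. -/
theorem stmt11 {n : ℕ} (A : Matrix (Fin n) (Fin n) ℝ)
    (hminor : ∀ (k : ℕ) (r c : Fin k → Fin n), StrictMono r → StrictMono c →
      0 < (A.submatrix r c).det) :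
    ∃ lam : Fin n → ℝ, StrictMono lam ∧ (∀ i, 0 < lam i) ∧
      A.charpoly = ∏ i, (X - C (lam i)) := by
  cases n with
  | zero => exact ⟨Fin.elim0, fun i => i.elim0, fun i => i.elim0, by simp [Matrix.charpoly_isEmpty]⟩
  | succ n =>
    obtain ⟨lam, hmono, hpos, hprod, -⟩ :=
      Matrix.IsTotallyPositive.charpoly_interlaces (A := A) hminor (.inl rfl)
    exact ⟨lam, hmono, hpos, hprod⟩
end
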